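/- Let n be a real number, let a, b > 0, let μ be real and s ∈ {−1, 1}, and set ω := √(a/b) and ζ := x + μ·y − s·μ²·t. Let u : ℝ³ → ℝ, (t,x,y) ↦ u(t,x,y), be a smooth, strictly positive solution of ∂x(∂t u + a·∂x(u^n) + b·∂x³(u^n)) + s·∂y² u = 0 (the KP(m,n) equation with m = n). Then the following conservation law identity holds at every point: ∂t(ω·sin(ω·ζ)·u) + ∂x(cos(ω·ζ)·(∂t u + b·∂x³(u^n)) + b·ω·sin(ω·ζ)·∂x²(u^n)) + ∂y(s·cos(ω·ζ)·∂y u + s·μ·ω·sin(ω·ζ)·u) = 0. -/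

import Mathlib

open Real

theorem ContDiff.deriv_infty {f : ℝ → ℝ} (hf : ContDiff ℝ (⊤ : ℕ∞) f) :
    ContDiff ℝ (⊤ : ℕ∞) (deriv f) :=
  (contDiff_infty_iff_deriv.mp hf).2

theorem ContDiff.hasDerivAt_infty {f : ℝ → ℝ} (hf : ContDiff ℝ (⊤ : ℕ∞) f) (x : ℝ) :
    HasDerivAt f (deriv f x) x :=
  (hf.differentiable (by simp) x).hasDerivAt

/-- The partial derivative of a smooth function in its first variable is smooth in the second. -/
theorem ContDiff.deriv_partial {f : ℝ → ℝ → ℝ}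
    (hf : ContDiff ℝ (⊤ : ℕ∞) (fun p : ℝ × ℝ => f p.1 p.2)) (t : ℝ) :
    ContDiff ℝ (⊤ : ℕ∞) (fun x : ℝ => deriv (fun t' : ℝ => f t' x) t) := by
  have h (x : ℝ) : deriv (fun t' : ℝ => f t' x) t
      = fderiv ℝ (fun p : ℝ × ℝ => f p.1 p.2) (t, x) (1, 0) := by
    have hd := (hf.differentiable (by simp) (t, x)).hasFDerivAt
    have hg : HasDerivAt (fun t' : ℝ => (t', x)) ((1 : ℝ), (0 : ℝ)) t :=
      (hasDerivAt_id t).prodMk (hasDerivAt_const t x)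
    exact (hd.comp_hasDerivAt t hg).deriv
  simp only [h]
  have hF : ContDiff ℝ (⊤ : ℕ∞) (fderiv ℝ (fun p : ℝ × ℝ => f p.1 p.2)) :=
    hf.fderiv_right (by simp)
  exact (hF.comp (contDiff_const.prodMk contDiff_id)).clm_apply contDiff_const

/-- The trigonometrically weighted mass conservation law of the
KP(n,n) equation, with weight functions built from ω = √(a/b) and
ζ = x + μy − sμ²t, holds on smooth positive solutions. -/
theorem kp_weighted_mass_conservation_law
    (n a b μ s : ℝ) (ha : 0 < a) (hb : 0 < b) (hs : s = 1 ∨ s = -1)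
    (u : ℝ → ℝ → ℝ → ℝ)
    (hsmooth : ContDiff ℝ (⊤ : ℕ∞) (fun p : ℝ × ℝ × ℝ => u p.1 p.2.1 p.2.2))
    (hpos : ∀ t x y : ℝ, 0 < u t x y)
    (hKP : ∀ t x y : ℝ,
      deriv (fun x' : ℝ =>
          deriv (fun t' : ℝ => u t' x' y) t
          + a * deriv (fun x'' : ℝ => u t x'' y ^ n) x'
          + b * deriv (deriv (deriv (fun x'' : ℝ => u t x'' y ^ n))) x') x
      + s * deriv (deriv (fun y' : ℝ => u t x y')) y = 0) :
    ∀ t x y : ℝ,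
      deriv (fun t' : ℝ =>
          Real.sqrt (a / b) * Real.sin (Real.sqrt (a / b) * (x + μ * y - s * μ ^ 2 * t'))
            * u t' x y) t
      + deriv (fun x' : ℝ =>
          Real.cos (Real.sqrt (a / b) * (x' + μ * y - s * μ ^ 2 * t)) *
            (deriv (fun t' : ℝ => u t' x' y) t
             + b * deriv (deriv (deriv (fun x'' : ℝ => u t x'' y ^ n))) x')
          + b * Real.sqrt (a / b)
            * Real.sin (Real.sqrt (a / b) * (x' + μ * y - s * μ ^ 2 * t))
            * deriv (deriv (fun x'' : ℝ => u t x'' y ^ n)) x') x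
      + deriv (fun y' : ℝ =>
          s * Real.cos (Real.sqrt (a / b) * (x + μ * y' - s * μ ^ 2 * t))
            * deriv (fun y'' : ℝ => u t x y'') y'
          + s * μ * Real.sqrt (a / b)
            * Real.sin (Real.sqrt (a / b) * (x + μ * y' - s * μ ^ 2 * t))
            * u t x y') y = 0 := by
  intro t x y
  have hab : b * √(a / b) ^ 2 = a := by
    rw [Real.sq_sqrt (by positivity)]
    field_simp
  set ω := √(a / b)
  have hut : ContDiff ℝ (⊤ : ℕ∞) (fun t' : ℝ => u t' x y) :=
    hsmooth.comp (contDiff_id.prodMk (contDiff_const (c := (x, y))))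
  have hux : ContDiff ℝ (⊤ : ℕ∞) (fun x' : ℝ => u t x' y) :=
    hsmooth.comp (contDiff_const.prodMk (contDiff_id.prodMk contDiff_const))
  have huy : ContDiff ℝ (⊤ : ℕ∞) (fun y' : ℝ => u t x y') :=
    hsmooth.comp (contDiff_const.prodMk (contDiff_const.prodMk contDiff_id))
  have hutx : ContDiff ℝ (⊤ : ℕ∞) (fun x' : ℝ => deriv (fun t' : ℝ => u t' x' y) t) :=
    ContDiff.deriv_partial (f := fun t' x' => u t' x' y)
      (hsmooth.comp (contDiff_fst.prodMk (contDiff_snd.prodMk contDiff_const))) t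
  have hw : ContDiff ℝ (⊤ : ℕ∞) (fun x' : ℝ => u t x' y ^ n) :=
    hux.rpow_const_of_ne fun x' => (hpos t x' y).ne'
  have hKP' := hKP t x y
  set w := fun x' : ℝ => u t x' y ^ n
  have hw1 := hw.deriv_infty
  have hw2 := hw1.deriv_infty
  have hw3 := hw2.deriv_infty
  have hθt : HasDerivAt (fun t' : ℝ => ω * (x + μ * y - s * μ ^ 2 * t'))
      (ω * (-(s * μ ^ 2 * 1))) t :=
    (((hasDerivAt_id t).const_mul (s * μ ^ 2)).const_sub (x + μ * y)).const_mul ω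
  have hθx : HasDerivAt (fun x' : ℝ => ω * (x' + μ * y - s * μ ^ 2 * t)) (ω * 1) x :=
    (((hasDerivAt_id x).add_const (μ * y)).sub_const (s * μ ^ 2 * t)).const_mul ω
  have hθy : HasDerivAt (fun y' : ℝ => ω * (x + μ * y' - s * μ ^ 2 * t)) (ω * (μ * 1)) y :=
    ((((hasDerivAt_id y).const_mul μ).const_add x).sub_const (s * μ ^ 2 * t)).const_mul ω
  have hK := ((hutx.hasDerivAt_infty x).fun_add ((hw1.hasDerivAt_infty x).const_mul a)).fun_add
    ((hw3.hasDerivAt_infty x).const_mul b)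
  have hT := (hθt.sin.const_mul ω).fun_mul (hut.hasDerivAt_infty t)
  have hX := (hθx.cos.fun_mul
    ((hutx.hasDerivAt_infty x).fun_add ((hw3.hasDerivAt_infty x).const_mul b))).fun_add
    ((hθx.sin.const_mul (b * ω)).fun_mul (hw2.hasDerivAt_infty x))
  have hY := ((hθy.cos.const_mul s).fun_mul (huy.deriv_infty.hasDerivAt_infty y)).fun_add
    ((hθy.sin.const_mul (s * μ * ω)).fun_mul (huy.hasDerivAt_infty y))
  rw [hK.deriv] at hKP'
  rw [hT.deriv, hX.deriv, hY.deriv]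
  linear_combination cos (ω * (x + μ * y - s * μ ^ 2 * t)) * hKP' +
    cos (ω * (x + μ * y - s * μ ^ 2 * t)) * deriv (deriv w) x * hab
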